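/- arXiv:2007.02916 — 4 statements merged into one kernel-verified Lean document; each statement's English description precedes it below -/
import Mathlib

section
/- Let n ≥ 1, let Q be an n×n complex matrix, let β ∈ ℂ, and let Ψ be the 2n×2n block matrix Ψ = [[(1+β)Q, −βQ], [I, 0]]. Then a complex number λ is an eigenvalue of Ψ if and only if there exists an eigenvalue μ of Q such that λ² − (1+β)μλ + βμ = 0. -/
/-- The companion linearization of the matrix polynomial `lam ^ 2 + lam * A + B` is singular exactly
when the polynomial is. -/
lemma det_companion_linearization_eq_zero_iff {m R : Type*} [Fintype m] [DecidableEq m]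
    [CommRing R] [IsDomain R] (A B : Matrix m m R) (lam : R) :
    (lam • (1 : Matrix (m ⊕ m) (m ⊕ m) R) - Matrix.fromBlocks (-A) (-B) 1 0).det = 0 ↔
      (lam ^ 2 • (1 : Matrix m m R) + lam • A + B).det = 0 := by
  have hinv : (Matrix.fromBlocks (lam • 1) (-1) 1 0 : Matrix (m ⊕ m) (m ⊕ m) R) *
      Matrix.fromBlocks 0 1 (-1) (lam • 1) = 1 := by
    simp [Matrix.fromBlocks_multiply]
  have hdet : (Matrix.fromBlocks (lam • 1) (-1) 1 0 : Matrix (m ⊕ m) (m ⊕ m) R).det ≠ 0 := by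
    intro h
    simpa [h] using congrArg Matrix.det hinv
  have hmul : (lam • (1 : Matrix (m ⊕ m) (m ⊕ m) R) - Matrix.fromBlocks (-A) (-B) 1 0) *
      Matrix.fromBlocks (lam • 1) (-1) 1 0 =
      Matrix.fromBlocks (lam ^ 2 • 1 + lam • A + B) (-(lam • 1 + A)) 0 1 := by
    rw [← Matrix.fromBlocks_one, Matrix.fromBlocks_smul, sub_eq_add_neg,
      Matrix.fromBlocks_neg, Matrix.fromBlocks_add,
      Matrix.fromBlocks_multiply]
    simp [smul_smul, pow_two, smul_add]
  have h := congrArg Matrix.det hmul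
  rw [Matrix.det_mul, Matrix.det_fromBlocks_zero₂₁, Matrix.det_one, mul_one] at h
  rw [← h, mul_eq_zero, or_iff_left hdet]

lemma exists_det_smul_one_sub_eq_zero {m K : Type*} [Fintype m] [DecidableEq m] [Nonempty m]
    [Field K] [IsAlgClosed K] (Q : Matrix m m K) :
    ∃ μ : K, (μ • (1 : Matrix m m K) - Q).det = 0 := by
  obtain ⟨μ, hμ⟩ := IsAlgClosed.exists_root Q.charpoly (by
    rw [Matrix.charpoly_degree_eq_dim]
    exact_mod_cast Fintype.card_ne_zero)
  refine ⟨μ, ?_⟩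
  rwa [Polynomial.IsRoot, Matrix.eval_charpoly, Matrix.scalar_apply,
    ← Matrix.smul_one_eq_diagonal] at hμ

lemma det_smul_one_sub_smul_eq_zero_iff {m K : Type*} [Fintype m] [DecidableEq m] [Nonempty m]
    [Field K] [IsAlgClosed K] (Q : Matrix m m K) (a c : K) :
    (a • (1 : Matrix m m K) - c • Q).det = 0 ↔
      ∃ μ : K, (μ • (1 : Matrix m m K) - Q).det = 0 ∧ a = c * μ := by
  rcases eq_or_ne c 0 with rfl | hc
  · obtain ⟨μ, hμ⟩ := exists_det_smul_one_sub_eq_zero Q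
    simp only [zero_smul, sub_zero, zero_mul, Matrix.det_smul, Matrix.det_one, mul_one,
      pow_eq_zero_iff Fintype.card_ne_zero]
    exact ⟨fun h => ⟨μ, hμ, h⟩, fun ⟨_, _, h⟩ => h⟩
  · have key (μ : K) : ((c * μ) • (1 : Matrix m m K) - c • Q).det = 0 ↔
        (μ • (1 : Matrix m m K) - Q).det = 0 := by
      rw [mul_smul, ← smul_sub, Matrix.det_smul, mul_eq_zero, or_iff_right (pow_ne_zero _ hc)]
    constructor
    · intro h
      refine ⟨a / c, ?_, (mul_div_cancel₀ a hc).symm⟩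
      rwa [← key, mul_div_cancel₀ a hc]
    · rintro ⟨μ, hμ, rfl⟩
      exact (key μ).2 hμ

/-- For `n ≥ 1`, an `n×n` complex matrix `Q`, `β ∈ ℂ`, and the `2n×2n`
block matrix `Ψ = [[(1+β)Q, −βQ], [I, 0]]`, a complex number `λ` is an eigenvalue of `Ψ`
(i.e. `det(λI − Ψ) = 0`) iff there exists an eigenvalue `μ` of `Q` with
`λ² − (1+β)μλ + βμ = 0`. -/
theorem stmt1 (n : ℕ) (hn : 1 ≤ n) (Q : Matrix (Fin n) (Fin n) ℂ) (β lam : ℂ) :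
    (lam • (1 : Matrix (Fin n ⊕ Fin n) (Fin n ⊕ Fin n) ℂ) -
        Matrix.fromBlocks ((1 + β) • Q) ((-β) • Q) (1 : Matrix (Fin n) (Fin n) ℂ) 0).det = 0 ↔
      ∃ μ : ℂ, (μ • (1 : Matrix (Fin n) (Fin n) ℂ) - Q).det = 0 ∧
        lam ^ 2 - (1 + β) * μ * lam + β * μ = 0 := by
  have : NeZero n := ⟨by omega⟩
  have h := det_companion_linearization_eq_zero_iff (-((1 + β) • Q)) (β • Q) lam
  have hpoly : lam ^ 2 • (1 : Matrix (Fin n) (Fin n) ℂ) + lam • -((1 + β) • Q) + β • Q =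
      lam ^ 2 • (1 : Matrix (Fin n) (Fin n) ℂ) - ((1 + β) * lam - β) • Q := by
    module
  rw [neg_neg, ← neg_smul, hpoly, det_smul_one_sub_smul_eq_zero_iff] at h
  rw [h]
  refine exists_congr fun μ => and_congr_right fun _ => ?_
  rw [← sub_eq_zero]
  ring_nf
end

section
/- Let ρ > 0 and define q : ℝ² → ℝ² by q(z, u) = ((ρ/(1+ρ))z + (1/(1+ρ))u − 1/ρ, 1/ρ) if (ρz + u)/(1+ρ) > 1/ρ; q(z, u) = (0, (ρ/(1+ρ))z + (1/(1+ρ))u) if |(ρz + u)/(1+ρ)| ≤ 1/ρ; and q(z, u) = ((ρ/(1+ρ))z + (1/(1+ρ))u + 1/ρ, −1/ρ) if (ρz + u)/(1+ρ) < −1/ρ. Then q(0, 0) = (0, 0), and q is Fréchet differentiable at (0, 0) with derivative the linear map (z, u) ↦ (0, (ρ/(1+ρ))z + (1/(1+ρ))u), i.e. the Jacobian matrix [[0, 0], [ρ/(1+ρ), 1/(1+ρ)]]. -/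
/-- The fixed-point-iteration representation `q(z,u)` of ADMM with penalty parameter `ρ`
applied to `min (1/2)x² + |x|`, obtained by eliminating the `x`-variable. -/
noncomputable def qADMM (ρ : ℝ) : ℝ × ℝ → ℝ × ℝ := fun p =>
  if (ρ * p.1 + p.2) / (1 + ρ) > 1 / ρ then
    ((ρ / (1 + ρ)) * p.1 + (1 / (1 + ρ)) * p.2 - 1 / ρ, 1 / ρ)
  else if (ρ * p.1 + p.2) / (1 + ρ) < -(1 / ρ) then
    ((ρ / (1 + ρ)) * p.1 + (1 / (1 + ρ)) * p.2 + 1 / ρ, -(1 / ρ))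
  else
    (0, (ρ / (1 + ρ)) * p.1 + (1 / (1 + ρ)) * p.2)

open Filter Topology in
/-- Near the origin neither threshold is active, so `qADMM ρ` agrees with its middle branch. -/
theorem qADMM_eventuallyEq (ρ : ℝ) (hρ : 0 < ρ) :
    qADMM ρ =ᶠ[𝓝 (0, 0)]
      fun p => (0, (ρ / (1 + ρ)) * p.1 + (1 / (1 + ρ)) * p.2) := by
  have hpos : 0 < 1 / ρ := by positivity
  have hcont : ContinuousAt (fun p : ℝ × ℝ => (ρ * p.1 + p.2) / (1 + ρ)) (0, 0) := by
    fun_prop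
  have hlt : ∀ᶠ p : ℝ × ℝ in 𝓝 (0, 0), (ρ * p.1 + p.2) / (1 + ρ) < 1 / ρ :=
    hcont.eventually_lt_const (by simpa using hpos)
  have hgt : ∀ᶠ p : ℝ × ℝ in 𝓝 (0, 0), -(1 / ρ) < (ρ * p.1 + p.2) / (1 + ρ) :=
    hcont.eventually_const_lt (by simpa using hpos)
  filter_upwards [hlt, hgt] with p h₁ h₂
  simp only [qADMM, if_neg (not_lt.mpr h₁.le), if_neg (not_lt.mpr h₂.le), gt_iff_lt]

/-- For `ρ > 0`, `(0,0)` is a fixed point of `q`, and `q` is Fréchet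
differentiable at `(0,0)` with derivative `(z,u) ↦ (0, (ρ/(1+ρ))z + (1/(1+ρ))u)`,
i.e. Jacobian `[[0,0],[ρ/(1+ρ), 1/(1+ρ)]]`. -/
theorem stmt15 (ρ : ℝ) (hρ : 0 < ρ) :
    qADMM ρ (0, 0) = (0, 0) ∧
    HasFDerivAt (qADMM ρ)
      (ContinuousLinearMap.prod (0 : ℝ × ℝ →L[ℝ] ℝ)
        ((ρ / (1 + ρ)) • ContinuousLinearMap.fst ℝ ℝ ℝ +
          (1 / (1 + ρ)) • ContinuousLinearMap.snd ℝ ℝ ℝ)) (0, 0) := by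
  have heq := qADMM_eventuallyEq ρ hρ
  refine ⟨by simpa using heq.eq_of_nhds, HasFDerivAt.congr_of_eventuallyEq ?_ heq⟩
  exact ContinuousLinearMap.hasFDerivAt
    (ContinuousLinearMap.prod (0 : ℝ × ℝ →L[ℝ] ℝ)
      ((ρ / (1 + ρ)) • ContinuousLinearMap.fst ℝ ℝ ℝ +
        (1 / (1 + ρ)) • ContinuousLinearMap.snd ℝ ℝ ℝ))
end

section
/- Let n ≥ 1, let f₂ : ℝⁿ → ℝ be differentiable, let B be an invertible n×n real matrix, let A be an m×n real matrix (for problems with n_b = n constraints), let b, u ∈ ℝⁿ, x₊ ∈ ℝ^{n₁} with Ax₊ ∈ ℝⁿ, and let ρ > 0. Suppose z₊ ∈ ℝⁿ is a local minimizer of the function z ↦ f₂(z) + (ρ/2)‖Ax₊ + Bz − b + u‖², where ‖·‖ is the Euclidean norm. Then, defining u₊ = u + Ax₊ + Bz₊ − b (the ADMM dual update), one has u₊ = −(1/ρ)·B^{−T}·∇f₂(z₊), where B^{−T} denotes the inverse of the transpose of B and ∇f₂ its gradient. -/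
open Matrix

/-- A local minimizer of `f + (ρ/2)‖c + B z‖²` satisfies the stationarity condition
`f'(z₀) v + ρ ⟨c + B z₀, B v⟩ = 0` in every direction `v`. -/
theorem IsLocalMin.fderiv_add_sum_sq_mulVec_eq_zero {m n : Type*} [Fintype m] [Fintype n]
    {f : (n → ℝ) → ℝ} {B : Matrix m n ℝ} {c : m → ℝ} {ρ : ℝ} {z₀ : n → ℝ}
    (hf : DifferentiableAt ℝ f z₀)
    (hmin : IsLocalMin (fun z => f z + (ρ / 2) * ∑ i, (c i + (B *ᵥ z) i) ^ 2) z₀)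
    (v : n → ℝ) :
    fderiv ℝ f z₀ v + ρ * ((c + B *ᵥ z₀) ⬝ᵥ (B *ᵥ v)) = 0 := by
  have hlin (i : m) : HasFDerivAt (fun z : n → ℝ => (B *ᵥ z) i)
      ((ContinuousLinearMap.proj i : (m → ℝ) →L[ℝ] ℝ) ∘L B.mulVecLin.toContinuousLinearMap)
      z₀ :=
    ((ContinuousLinearMap.proj i : (m → ℝ) →L[ℝ] ℝ) ∘L
      B.mulVecLin.toContinuousLinearMap).hasFDerivAt
  have hderiv := hf.hasFDerivAt.add ((HasFDerivAt.fun_sum (u := Finset.univ) fun i _ =>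
    ((hlin i).const_add (c i)).pow 2).const_mul (ρ / 2))
  have hzero := DFunLike.congr_fun (hmin.hasFDerivAt_eq_zero hderiv) v
  simp only [_root_.add_apply, _root_.smul_apply,
    _root_.sum_apply, ContinuousLinearMap.comp_apply,
    ContinuousLinearMap.proj_apply, LinearMap.coe_toContinuousLinearMap', mulVecLin_apply,
    _root_.zero_apply, smul_eq_mul] at hzero
  rw [← hzero, dotProduct, Finset.mul_sum, Finset.mul_sum]
  congr 1
  refine Finset.sum_congr rfl fun i _ => ?_
  simp
  ring

/-- In ADMM, if `B` is square and nonsingular, `f₂` is differentiable, and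
`z₊` is a local minimizer of `z ↦ f₂(z) + (ρ/2)‖Ax₊ + Bz − b + u‖²` (Euclidean norm), then
the dual update `u₊ = u + Ax₊ + Bz₊ − b` satisfies `u₊ = −(1/ρ)·B^{−T}·∇f₂(z₊)`.
Here the gradient `∇f₂(z₊)` is the vector `g` representing the Fréchet derivative of `f₂`
at `z₊` with respect to the Euclidean inner product. -/
theorem stmt17 (n n₁ : ℕ) (hn : 1 ≤ n)
    (f₂ : (Fin n → ℝ) → ℝ) (hf₂ : Differentiable ℝ f₂)
    (B : Matrix (Fin n) (Fin n) ℝ) (hB : IsUnit B.det)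
    (A : Matrix (Fin n) (Fin n₁) ℝ) (b u : Fin n → ℝ) (xp : Fin n₁ → ℝ)
    (ρ : ℝ) (hρ : 0 < ρ) (zp : Fin n → ℝ)
    (hmin : IsLocalMin
      (fun z : Fin n → ℝ =>
        f₂ z + (ρ / 2) * ∑ i, (A.mulVec xp i + B.mulVec z i - b i + u i) ^ 2) zp)
    (g : Fin n → ℝ) (hg : ∀ v : Fin n → ℝ, fderiv ℝ f₂ zp v = ∑ i, g i * v i) :
    u + A.mulVec xp + B.mulVec zp - b = -(1 / ρ) • (Bᵀ)⁻¹.mulVec g := by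
  have hmin' : IsLocalMin (fun z : Fin n → ℝ =>
      f₂ z + (ρ / 2) * ∑ i, ((u + A *ᵥ xp - b) i + (B *ᵥ z) i) ^ 2) zp := by
    convert hmin using 6
    simp only [Pi.add_apply, Pi.sub_apply]
    ring
  have hg_eq : g = -ρ • (Bᵀ *ᵥ (u + A *ᵥ xp - b + B *ᵥ zp)) := by
    refine dotProduct_eq _ _ fun v => ?_
    have hv := hmin'.fderiv_add_sum_sq_mulVec_eq_zero (hf₂ zp) v
    rw [hg v, dotProduct_mulVec, ← mulVec_transpose] at hv
    rw [smul_dotProduct, smul_eq_mul]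
    simp only [dotProduct] at hv ⊢
    linarith
  rw [hg_eq, mulVec_smul, mulVec_mulVec, nonsing_inv_mul _ (by rwa [det_transpose]), one_mulVec,
    smul_smul, neg_mul_neg, one_div_mul_cancel hρ.ne', one_smul]
  abel
end

section
/- Let A be an m×n real matrix, b ∈ ℝ^m, λ > 0, ρ > 0, and z, u ∈ ℝⁿ with u = (2λ/ρ)z. Define the ridge-regression ADMM update x₊ = (AᵀA + ρI)^{−1}(Aᵀb + ρ(z − u)), z₊ = (ρ/(2λ + ρ))(x₊ + u), u₊ = u + x₊ − z₊. Then u₊ = (2λ/ρ)z₊, and z₊ = M·z + b̂, where M = (ρ(ρ − 2λ)/(ρ + 2λ))·(AᵀA + ρI)^{−1} + (2λ/(ρ + 2λ))·I and b̂ = (ρ/(ρ + 2λ))·(AᵀA + ρI)^{−1}Aᵀb; that is, one full ADMM step for ridge regression reduces to the stationary affine fixed-point iteration z ↦ Mz + b̂. -/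
open Matrix

/-- One full ADMM step for ridge regression, starting from `(z, u)` with
`u = (2·lam/ρ)·z`, preserves the relation `u₊ = (2·lam/ρ)·z₊` and reduces to the stationary
affine fixed-point iteration `z ↦ Mz + b̂` with
`M = (ρ(ρ−2·lam)/(ρ+2·lam))(AᵀA + ρI)⁻¹ + (2·lam/(ρ+2·lam))I` and
`b̂ = (ρ/(ρ+2·lam))(AᵀA + ρI)⁻¹ Aᵀ b`. -/
theorem stmt19 (m n : ℕ) (A : Matrix (Fin m) (Fin n) ℝ) (b : Fin m → ℝ)
    (lam ρ : ℝ) (hlam : 0 < lam) (hρ : 0 < ρ)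
    (z u : Fin n → ℝ) (hu : u = (2 * lam / ρ) • z)
    (xp zp up : Fin n → ℝ)
    (hxp : xp = (Aᵀ * A + ρ • (1 : Matrix (Fin n) (Fin n) ℝ))⁻¹.mulVec
      (Aᵀ.mulVec b + ρ • (z - u)))
    (hzp : zp = (ρ / (2 * lam + ρ)) • (xp + u))
    (hup : up = u + xp - zp) :
    up = (2 * lam / ρ) • zp ∧
    zp = ((ρ * (ρ - 2 * lam) / (ρ + 2 * lam)) •
            (Aᵀ * A + ρ • (1 : Matrix (Fin n) (Fin n) ℝ))⁻¹ +
          (2 * lam / (ρ + 2 * lam)) • (1 : Matrix (Fin n) (Fin n) ℝ)).mulVec z +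
        (ρ / (ρ + 2 * lam)) •
          (Aᵀ * A + ρ • (1 : Matrix (Fin n) (Fin n) ℝ))⁻¹.mulVec (Aᵀ.mulVec b) := by
  have hsum : ρ + 2 * lam ≠ 0 := by positivity
  have hsum' : 2 * lam + ρ ≠ 0 := by positivity
  have hρ' : ρ ≠ 0 := hρ.ne'
  have hdiff : ρ • (z - u) = (ρ - 2 * lam) • z := by
    ext i
    simp only [hu, Pi.smul_apply, Pi.sub_apply, smul_eq_mul]
    field_simp
  constructor
  · ext i
    simp only [hup, hzp, Pi.smul_apply, Pi.sub_apply, Pi.add_apply, smul_eq_mul]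
    field_simp
    ring
  · rw [hdiff, mulVec_add, mulVec_smul] at hxp
    rw [add_mulVec, smul_mulVec, smul_mulVec, one_mulVec]
    ext i
    simp only [hzp, hxp, hu, Pi.smul_apply, Pi.add_apply, smul_eq_mul]
    field_simp
    ring
end
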